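/- arXiv:1810.08001 — 2 statements merged into one kernel-verified Lean document; each statement's English description precedes it below -/
import Mathlib

section
/- Let H_A, H_B be finite-dimensional Hilbert spaces and 0 ≠ p ∈ B(H_B ⊗ H_A) an orthogonal projection with range H₀. If the state ρ := p / dim(H₀) is separable, then H₀ contains a nonzero product vector ξ ⊗ η with ξ ∈ H_B, η ∈ H_A. Equivalently, if every nonzero vector of H₀ is entangled, then ρ is entangled. -/
/-- The product vector `ξ ⊗ η ∈ H_B ⊗ H_A`. -/
def prodVec {dB dA : ℕ} (ξ : Fin dB → ℂ) (η : Fin dA → ℂ) : Fin dB × Fin dA → ℂ :=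
  fun p => ξ p.1 * η p.2

/-- A vector annihilated by a nonnegative combination of rank-one operators `|vᵢ⟩⟨vᵢ|` is
orthogonal to every `vᵢ` with nonzero weight. -/
theorem star_dotProduct_eq_zero_of_sum_mulVec_eq_zero {ι n : Type*} [Fintype ι] [Fintype n]
    (c : ι → ℝ) (hc : ∀ i, 0 ≤ c i) (v : ι → n → ℂ) (w : n → ℂ)
    (h : (∑ i, (c i : ℂ) • Matrix.vecMulVec (v i) (star (v i))).mulVec w = 0)
    (i : ι) (hi : c i ≠ 0) : star (v i) ⬝ᵥ w = 0 := by
  have hsum : ∑ j, c j * Complex.normSq (star (v j) ⬝ᵥ w) = 0 := by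
    have h0 := congrArg (star w ⬝ᵥ ·) h
    simp only [Matrix.sum_mulVec, dotProduct_sum, Matrix.smul_mulVec, Matrix.vecMulVec_mulVec,
      dotProduct_smul, dotProduct_zero] at h0
    apply Complex.ofReal_injective
    push_cast
    rw [← h0]
    refine Finset.sum_congr rfl fun j _ => ?_
    have hstar : star w ⬝ᵥ v j = star (star (v j) ⬝ᵥ w) := by
      rw [Matrix.star_dotProduct]
    simp [hstar, Complex.normSq_eq_conj_mul_self, mul_comm]
  have hterm := (Finset.sum_eq_zero_iff_of_nonneg
    fun j _ => mul_nonneg (hc j) (Complex.normSq_nonneg _)).1 hsum i (Finset.mem_univ i)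
  exact Complex.normSq_eq_zero.1 ((mul_eq_zero.1 hterm).resolve_left hi)

open scoped ComplexOrder in
/-- If `p` is an orthogonal projection and `v - p v` is orthogonal to `v`, then `v` lies in the
range of `p`. -/
theorem Matrix.IsHermitian.mulVec_eq_self_of_star_dotProduct_sub_eq_zero {n : Type*} [Fintype n]
    {p : Matrix n n ℂ} (hp : p.IsHermitian) (hidem : p * p = p) {v : n → ℂ}
    (h : star v ⬝ᵥ (v - p.mulVec v) = 0) : p.mulVec v = v := by
  have hpv : star (p.mulVec v) ⬝ᵥ (v - p.mulVec v) = 0 := by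
    rw [Matrix.star_mulVec, hp.eq, ← Matrix.dotProduct_mulVec, Matrix.mulVec_sub,
      Matrix.mulVec_mulVec, hidem, sub_self, dotProduct_zero]
  have hw : star (v - p.mulVec v) ⬝ᵥ (v - p.mulVec v) = 0 := by
    rw [star_sub, sub_dotProduct, h, hpv, sub_zero]
  exact (sub_eq_zero.1 (dotProduct_star_self_eq_zero.1 hw)).symm

/-- if `p ≠ 0` is an orthogonal projection on `H_B ⊗ H_A` and the state
`ρ = p / dim(ran p)` is separable, then the range of `p` contains a nonzero product vector. -/
theorem stmt_11 (dB dA : ℕ) (p : Matrix (Fin dB × Fin dA) (Fin dB × Fin dA) ℂ)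
    (hp : p.IsHermitian) (hidem : p * p = p) (hne : p ≠ 0)
    (hsep : ∃ (m : ℕ) (c : Fin m → ℝ) (ξ : Fin m → Fin dB → ℂ) (η : Fin m → Fin dA → ℂ),
      (∀ i, 0 ≤ c i) ∧ (∀ i, ξ i ≠ 0) ∧ (∀ i, η i ≠ 0) ∧
      ((p.rank : ℂ))⁻¹ • p =
        ∑ i, (c i : ℂ) • Matrix.vecMulVec (prodVec (ξ i) (η i)) (star (prodVec (ξ i) (η i)))) :
    ∃ (ξ : Fin dB → ℂ) (η : Fin dA → ℂ), ξ ≠ 0 ∧ η ≠ 0 ∧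
      p.mulVec (prodVec ξ η) = prodVec ξ η := by
  obtain ⟨m, c, ξ, η, hc, hξ, hη, hρ⟩ := hsep
  have hrank : p.rank ≠ 0 := fun h => hne <| by
    rw [Matrix.rank, Submodule.finrank_eq_zero, LinearMap.range_eq_bot] at h
    exact Matrix.toLin'.map_eq_zero_iff.1 h
  obtain ⟨i, hi⟩ : ∃ i, c i ≠ 0 := by
    by_contra! hzero
    refine smul_ne_zero (inv_ne_zero (Nat.cast_ne_zero.2 hrank)) hne (hρ.trans ?_)
    simp [hzero]
  refine ⟨ξ i, η i, hξ i, hη i,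
    hp.mulVec_eq_self_of_star_dotProduct_sub_eq_zero hidem ?_⟩
  refine star_dotProduct_eq_zero_of_sum_mulVec_eq_zero c hc
    (fun j => prodVec (ξ j) (η j)) _ ?_ i hi
  rw [← hρ, Matrix.smul_mulVec, Matrix.mulVec_sub, Matrix.mulVec_mulVec, hidem, sub_self,
    smul_zero]
end

section
/- Let Φ: B(H_A) → B(H_B) be a bistochastic quantum channel whose complementary channel Φ̃: B(H_A) → B(H_E) is also bistochastic. Then for every n ≥ 1, the Holevo capacity satisfies χ(Φ^{⊗n}) ≤ n · min{log d_A, log(d_A d_B / d_E)}, and hence the classical capacity C(Φ) = lim_n χ(Φ^{⊗n})/n satisfies C(Φ) ≤ min{log d_A, log d_B, log(d_A d_B / d_E)}. -/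
open scoped ComplexOrder Matrix

/-- Von Neumann entropy `H(ρ) = -Tr(ρ log ρ)` of a Hermitian matrix, via its eigenvalues. -/
noncomputable def entropy {α : Type} [Fintype α] [DecidableEq α]
    {ρ : Matrix α α ℂ} (hρ : ρ.IsHermitian) : ℝ :=
  -∑ i, hρ.eigenvalues i * Real.log (hρ.eigenvalues i)

/-- Partial trace over the environment. -/
noncomputable def ptraceE {dB dE : ℕ} (M : Matrix (Fin dB × Fin dE) (Fin dB × Fin dE) ℂ) :
    Matrix (Fin dB) (Fin dB) ℂ :=
  fun i j => ∑ e, M (i, e) (j, e)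

/-- Partial trace over the output. -/
noncomputable def ptraceB {dB dE : ℕ} (M : Matrix (Fin dB × Fin dE) (Fin dB × Fin dE) ℂ) :
    Matrix (Fin dE) (Fin dE) ℂ :=
  fun i j => ∑ b, M (b, i) (b, j)

/-- The `n`-fold tensor power `Φ^{⊗n}` of the channel `Φ(ρ) = Tr_E(VρV*)` with Stinespring
isometry `V : H_A → H_B ⊗ H_E`, written out in coordinates. -/
noncomputable def PhiPow {dA dB dE : ℕ} (V : Matrix (Fin dB × Fin dE) (Fin dA) ℂ) (n : ℕ)
    (ρ : Matrix (Fin n → Fin dA) (Fin n → Fin dA) ℂ) :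
    Matrix (Fin n → Fin dB) (Fin n → Fin dB) ℂ :=
  fun i j => ∑ e : Fin n → Fin dE, ∑ a : Fin n → Fin dA, ∑ a' : Fin n → Fin dA,
    (∏ t, V (i t, e t) (a t)) * ρ a a' * star (∏ t, V (j t, e t) (a' t))

/-- The set of Holevo quantities `H(Ψ(Σ p_x ρ_x)) - Σ p_x H(Ψ(ρ_x))` over all finite
ensembles of states. -/
noncomputable def holevoSet {α β : Type} [Fintype α] [DecidableEq α] [Fintype β] [DecidableEq β]
    (Ψ : Matrix α α ℂ → Matrix β β ℂ) : Set ℝ :=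
  {x | ∃ (mm : ℕ) (pr : Fin mm → ℝ) (ρ : Fin mm → Matrix α α ℂ)
      (_ : ∀ i, 0 ≤ pr i) (_ : ∑ i, pr i = 1)
      (_ : ∀ i, (ρ i).PosSemidef) (_ : ∀ i, (ρ i).trace = 1)
      (h : (Ψ (∑ i, (pr i : ℂ) • ρ i)).IsHermitian)
      (hs : ∀ i, (Ψ (ρ i)).IsHermitian),
      x = entropy h - ∑ i, pr i * entropy (hs i)}

/-- Holevo capacity `χ(Ψ)`. -/
noncomputable def holevo {α β : Type} [Fintype α] [DecidableEq α] [Fintype β] [DecidableEq β]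
    (Ψ : Matrix α α ℂ → Matrix β β ℂ) : ℝ :=
  sSup (holevoSet Ψ)

section Entropy

variable {α : Type} [Fintype α] [DecidableEq α] {ρ : Matrix α α ℂ}

lemma sum_eigenvalues_eq_one (h : ρ.IsHermitian) (htr : ρ.trace = 1) :
    ∑ i, h.eigenvalues i = 1 := by
  have := h.trace_eq_sum_eigenvalues
  rw [htr] at this
  simpa using (congrArg Complex.re this).symm

lemma neg_log_le_entropy (h : ρ.IsHermitian) (hp : ρ.PosSemidef) (htr : ρ.trace = 1)
    {c : ℝ} (hc : ∀ i, h.eigenvalues i ≤ c) : -Real.log c ≤ entropy h := by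
  have hs := sum_eigenvalues_eq_one h htr
  have key : ∑ i, h.eigenvalues i * Real.log (h.eigenvalues i)
      ≤ ∑ i, h.eigenvalues i * Real.log c := by
    refine Finset.sum_le_sum fun i _ => ?_
    rcases (hp.eigenvalues_nonneg i).eq_or_lt with h0 | h0
    · rw [← h0]; simp
    · exact mul_le_mul_of_nonneg_left (Real.log_le_log h0 (hc i)) h0.le
  rw [← Finset.sum_mul, hs, one_mul] at key
  unfold entropy
  linarith

lemma entropy_nonneg (h : ρ.IsHermitian) (hp : ρ.PosSemidef) (htr : ρ.trace = 1) :
    0 ≤ entropy h := by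
  have := neg_log_le_entropy h hp htr (c := 1) fun i => by
    rw [← sum_eigenvalues_eq_one h htr]
    exact Finset.single_le_sum (fun j _ => hp.eigenvalues_nonneg j) (Finset.mem_univ i)
  simpa using this

lemma entropy_le_log_card (h : ρ.IsHermitian) (hp : ρ.PosSemidef) (htr : ρ.trace = 1) :
    entropy h ≤ Real.log (Fintype.card α) := by
  have hs := sum_eigenvalues_eq_one h htr
  have hne : Nonempty α := by
    by_contra hα
    rw [not_nonempty_iff] at hα
    simp at hs
  have hd : (0 : ℝ) < Fintype.card α := by exact_mod_cast Fintype.card_pos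
  have key : ∑ i, h.eigenvalues i ≤ ∑ i, ((Fintype.card α : ℝ)⁻¹
      + h.eigenvalues i * (Real.log (h.eigenvalues i) + Real.log (Fintype.card α))) := by
    refine Finset.sum_le_sum fun i _ => ?_
    rcases (hp.eigenvalues_nonneg i).eq_or_lt with h0 | h0
    · rw [← h0]; simp
    · have hl := Real.log_le_sub_one_of_pos (inv_pos.2 (mul_pos h0 hd))
      rw [Real.log_inv, Real.log_mul h0.ne' hd.ne'] at hl
      have hm := mul_le_mul_of_nonneg_left hl h0.le
      have : h.eigenvalues i * ((h.eigenvalues i * (Fintype.card α : ℝ))⁻¹ - 1)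
          = (Fintype.card α : ℝ)⁻¹ - h.eigenvalues i := by
        field_simp
      linarith
  simp only [Finset.sum_add_distrib, mul_add, ← Finset.sum_mul, hs, Finset.sum_const,
    Finset.card_univ, nsmul_eq_mul, mul_inv_cancel₀ hd.ne', one_mul] at key
  unfold entropy
  linarith

lemma eigenvalues_le_of_re_quadratic_le (h : ρ.IsHermitian) {c : ℝ}
    (hc : ∀ v : α → ℂ, (star v ⬝ᵥ ρ *ᵥ v).re ≤ c * ∑ i, ‖v i‖ ^ 2) (i : α) :
    h.eigenvalues i ≤ c := by
  have h1 := hc (h.eigenvectorBasis i)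
  rw [← EuclideanSpace.norm_sq_eq, h.eigenvectorBasis.orthonormal.1 i] at h1
  rw [h.eigenvalues_eq]
  simpa using h1

end Entropy

lemma norm_sum_mul_sq_le {ι : Type*} [Fintype ι] (f g : ι → ℂ) :
    ‖∑ i, f i * g i‖ ^ 2 ≤ (∑ i, ‖f i‖ ^ 2) * ∑ i, ‖g i‖ ^ 2 := by
  refine le_trans ?_ (Finset.sum_mul_sq_le_sq_mul_sq _ _ _)
  gcongr
  exact (norm_sum_le _ _).trans_eq (by simp)

lemma sum_norm_sq_of_gram {ι X : Type*} [Fintype ι] [DecidableEq ι] [Fintype X]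
    (G : ι → X → ℂ) (c : ℝ)
    (hG : ∀ i j, ∑ x, G i x * star (G j x) = if i = j then (c : ℂ) else 0) (v : ι → ℂ) :
    ∑ x, ‖∑ i, G i x * v i‖ ^ 2 = c * ∑ i, ‖v i‖ ^ 2 := by
  have hn : ∀ z : ℂ, ((‖z‖ ^ 2 : ℝ) : ℂ) = z * star z := fun z => by
    rw [Complex.star_def, Complex.mul_conj, Complex.normSq_eq_norm_sq]
  apply Complex.ofReal_injective
  simp only [Complex.ofReal_sum, Complex.ofReal_mul, hn]
  calc ∑ x, (∑ i, G i x * v i) * star (∑ i, G i x * v i)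
      = ∑ x, ∑ i, ∑ j, (G i x * star (G j x)) * (v i * star (v j)) := by
        refine Finset.sum_congr rfl fun x _ => ?_
        rw [star_sum, Finset.sum_mul_sum]
        refine Finset.sum_congr rfl fun i _ => Finset.sum_congr rfl fun j _ => ?_
        rw [star_mul']; ring
    _ = ∑ i, ∑ j, (∑ x, G i x * star (G j x)) * (v i * star (v j)) := by
        rw [Finset.sum_comm]
        refine Finset.sum_congr rfl fun i _ => ?_
        rw [Finset.sum_comm]
        simp only [Finset.sum_mul]
    _ = _ := by
        simp only [hG, ite_mul, zero_mul, Finset.sum_ite_eq, Finset.mem_univ, if_true,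
          Finset.mul_sum]

section Channel

variable {A B E : Type} [Fintype A] [Fintype B] [Fintype E]

/-- The Kraus operator of `ρ ↦ Tr_E(UρU*)` belonging to the environment basis state `e`. -/
def krausOp (U : Matrix (B × E) A ℂ) (e : E) : Matrix B A ℂ :=
  Matrix.of fun i a => U (i, e) a

/-- The map `ρ ↦ Tr_E(UρU*)`. -/
def stinespring (U : Matrix (B × E) A ℂ) (ρ : Matrix A A ℂ) : Matrix B B ℂ :=
  ∑ e, krausOp U e * ρ * (krausOp U e)ᴴ

lemma stinespring_posSemidef (U : Matrix (B × E) A ℂ) {ρ : Matrix A A ℂ} (hρ : ρ.PosSemidef) :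
    (stinespring U ρ).PosSemidef :=
  Matrix.posSemidef_sum _ fun e _ => hρ.mul_mul_conjTranspose_same (krausOp U e)

lemma trace_stinespring [DecidableEq A] {U : Matrix (B × E) A ℂ} (hU : Uᴴ * U = 1) (ρ : Matrix A A ℂ) :
    (stinespring U ρ).trace = ρ.trace := by
  have hK : ∑ e, (krausOp U e)ᴴ * krausOp U e = 1 := by
    rw [← hU]
    ext a a'
    simp only [Matrix.sum_apply, Matrix.mul_apply, Matrix.conjTranspose_apply, krausOp,
      Matrix.of_apply, Fintype.sum_prod_type]
    exact Finset.sum_comm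
  calc (stinespring U ρ).trace = ∑ e, ((krausOp U e)ᴴ * krausOp U e * ρ).trace := by
        rw [stinespring, Matrix.trace_sum]
        refine Finset.sum_congr rfl fun e _ => ?_
        rw [Matrix.trace_mul_comm, ← Matrix.mul_assoc]
    _ = ρ.trace := by
        rw [← Matrix.trace_sum, ← Finset.sum_mul, hK, one_mul]

lemma re_quadratic_stinespring_le (U : Matrix (B × E) A ℂ) {c : ℝ}
    (hc : ∀ (b : A → ℂ) (v : B → ℂ),
      ∑ e, ‖∑ i, ∑ a, b a * star (U (i, e) a) * v i‖ ^ 2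
        ≤ c * (∑ a, ‖b a‖ ^ 2) * ∑ i, ‖v i‖ ^ 2)
    {ρ : Matrix A A ℂ} (hρ : ρ.PosSemidef) (htr : ρ.trace = 1) (v : B → ℂ) :
    (star v ⬝ᵥ stinespring U ρ *ᵥ v).re ≤ c * ∑ i, ‖v i‖ ^ 2 := by
  classical
  open scoped MatrixOrder Matrix.Norms.L2Operator in
  obtain ⟨b, rfl⟩ := CStarAlgebra.nonneg_iff_eq_star_mul_self.mp hρ.nonneg
  rw [Matrix.star_eq_conjTranspose] at *
  have hn : ∀ {ι : Type} [Fintype ι] (w : ι → ℂ), (star w ⬝ᵥ w).re = ∑ k, ‖w k‖ ^ 2 := by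
    intro ι _ w
    simp only [dotProduct, Complex.re_sum, Pi.star_apply]
    refine Finset.sum_congr rfl fun k _ => ?_
    rw [mul_comm, Complex.star_def, Complex.mul_conj, Complex.normSq_eq_norm_sq,
      Complex.ofReal_re]
  have hb : ∑ k, ∑ a, ‖b k a‖ ^ 2 = 1 := by
    have := congrArg Complex.re htr
    simp only [Matrix.trace, Matrix.diag, Matrix.mul_apply, Matrix.conjTranspose_apply] at this
    rw [Complex.re_sum, Complex.one_re] at this
    rw [Finset.sum_comm, ← this]
    exact Finset.sum_congr rfl fun a _ => (hn fun k => b k a).symm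
  have hq : (star v ⬝ᵥ stinespring U (bᴴ * b) *ᵥ v).re
      = ∑ k, ∑ e, ‖∑ i, ∑ a, b k a * star (U (i, e) a) * v i‖ ^ 2 := by
    rw [stinespring, Matrix.sum_mulVec, dotProduct_sum, Complex.re_sum, Finset.sum_comm]
    refine Finset.sum_congr rfl fun e _ => ?_
    have : krausOp U e * (bᴴ * b) * (krausOp U e)ᴴ
        = (b * (krausOp U e)ᴴ)ᴴ * (b * (krausOp U e)ᴴ) := by
      simp only [Matrix.conjTranspose_mul, Matrix.conjTranspose_conjTranspose, Matrix.mul_assoc]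
    rw [this, ← Matrix.mulVec_mulVec, Matrix.dotProduct_mulVec, ← Matrix.star_mulVec, hn]
    refine Finset.sum_congr rfl fun k _ => ?_
    simp only [Matrix.mulVec, dotProduct, Matrix.mul_apply, Matrix.conjTranspose_apply, krausOp,
      Matrix.of_apply, Finset.sum_mul]
  rw [hq]
  refine (Finset.sum_le_sum fun k _ => hc (b k) v).trans_eq ?_
  rw [← Finset.sum_mul, ← Finset.mul_sum, hb, mul_one]

lemma sum_norm_sq_le_of_unital [DecidableEq B] (U : Matrix (B × E) A ℂ) {c : ℝ}
    (hU : ∀ i j, ∑ e, ∑ a, U (i, e) a * star (U (j, e) a) = if i = j then (c : ℂ) else 0)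
    (b : A → ℂ) (v : B → ℂ) :
    ∑ e, ‖∑ i, ∑ a, b a * star (U (i, e) a) * v i‖ ^ 2
      ≤ c * (∑ a, ‖b a‖ ^ 2) * ∑ i, ‖v i‖ ^ 2 := by
  have hgram := sum_norm_sq_of_gram (fun i (x : E × A) => star (U (i, x.1) x.2)) c
    (fun i j => by
      rw [Fintype.sum_prod_type]
      simp only [star_star, mul_comm (star _)]
      rw [hU j i]
      simp only [eq_comm]) v
  rw [Fintype.sum_prod_type] at hgram
  calc ∑ e, ‖∑ i, ∑ a, b a * star (U (i, e) a) * v i‖ ^ 2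
      = ∑ e, ‖∑ a, b a * ∑ i, star (U (i, e) a) * v i‖ ^ 2 := by
        refine Finset.sum_congr rfl fun e _ => ?_
        rw [Finset.sum_comm]
        simp only [Finset.mul_sum, mul_assoc]
    _ ≤ ∑ e, (∑ a, ‖b a‖ ^ 2) * ∑ a, ‖∑ i, star (U (i, e) a) * v i‖ ^ 2 :=
        Finset.sum_le_sum fun e _ => norm_sum_mul_sq_le _ _
    _ = _ := by rw [← Finset.mul_sum, hgram]; ring

lemma sum_norm_sq_le_of_complementary_unital [DecidableEq E] (U : Matrix (B × E) A ℂ) {c : ℝ}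
    (hU : ∀ e f, ∑ i, ∑ a, U (i, e) a * star (U (i, f) a) = if e = f then (c : ℂ) else 0)
    (hc : 0 ≤ c) (b : A → ℂ) (v : B → ℂ) :
    ∑ e, ‖∑ i, ∑ a, b a * star (U (i, e) a) * v i‖ ^ 2
      ≤ c * (∑ a, ‖b a‖ ^ 2) * ∑ i, ‖v i‖ ^ 2 := by
  set y : E → ℂ := fun e => ∑ i, ∑ a, b a * star (U (i, e) a) * v i with hy
  set S := ∑ e, ‖y e‖ ^ 2 with hS
  have hS0 : 0 ≤ S := by positivity
  have hgram := sum_norm_sq_of_gram (fun e (x : B × A) => star (U (x.1, e) x.2)) c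
    (fun e f => by
      rw [Fintype.sum_prod_type]
      simp only [star_star, mul_comm (star _)]
      rw [hU f e]
      simp only [eq_comm]) (star y)
  have hSy : (S : ℂ) = ∑ x : B × A, (b x.2 * v x.1) * ∑ e, star (U (x.1, e) x.2) * star y e := by
    calc (S : ℂ) = ∑ e, y e * star (y e) := by
          rw [hS, Complex.ofReal_sum]
          refine Finset.sum_congr rfl fun e _ => ?_
          rw [Complex.star_def, Complex.mul_conj, Complex.normSq_eq_norm_sq]
      _ = ∑ e, ∑ x : B × A, (b x.2 * v x.1) * (star (U (x.1, e) x.2) * star y e) := by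
          refine Finset.sum_congr rfl fun e _ => ?_
          simp only [hy, Finset.sum_mul, Fintype.sum_prod_type]
          refine Finset.sum_congr rfl fun i _ => Finset.sum_congr rfl fun a _ => ?_
          simp only [Pi.star_apply]
          ring
      _ = _ := by
          rw [Finset.sum_comm]
          simp only [Finset.mul_sum]
  have hprod : ∑ x : B × A, ‖b x.2 * v x.1‖ ^ 2 = (∑ a, ‖b a‖ ^ 2) * ∑ i, ‖v i‖ ^ 2 := by
    rw [Fintype.sum_prod_type, Finset.sum_comm, Finset.sum_mul_sum]
    simp only [norm_mul, mul_pow]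
  have hstar : ∑ e, ‖(star y) e‖ ^ 2 = S := by simp [hS]
  have hle : S ^ 2 ≤ (∑ a, ‖b a‖ ^ 2) * (∑ i, ‖v i‖ ^ 2) * (c * S) := by
    have h1 := norm_sum_mul_sq_le (fun x : B × A => b x.2 * v x.1)
      (fun x => ∑ e, star (U (x.1, e) x.2) * star y e)
    rw [← hSy, hgram, hprod, hstar, Complex.norm_real, Real.norm_eq_abs, sq_abs] at h1
    exact h1
  rcases hS0.eq_or_lt with h0 | h0
  · rw [← h0]; positivity
  · refine le_of_mul_le_mul_right ?_ h0
    linarith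

lemma holevo_stinespring_le [DecidableEq A] [DecidableEq B] [Nonempty A]
    {U : Matrix (B × E) A ℂ} (hU : Uᴴ * U = 1) {m : ℝ}
    (hm : ∀ (ρ : Matrix A A ℂ) (h : (stinespring U ρ).IsHermitian),
      ρ.PosSemidef → ρ.trace = 1 → m ≤ entropy h) :
    holevo (stinespring U) ≤ Real.log (Fintype.card B) - m := by
  refine csSup_le ?_ ?_
  · have hp : ((Fintype.card A : ℂ)⁻¹ • (1 : Matrix A A ℂ)).PosSemidef :=
      Matrix.PosSemidef.one.smul (by positivity)
    refine ⟨_, 1, fun _ => 1, fun _ => (Fintype.card A : ℂ)⁻¹ • 1, fun _ => zero_le_one,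
      by simp, fun _ => hp, fun _ => ?_, ?_, fun _ => (stinespring_posSemidef U hp).1, rfl⟩
    · simp [Matrix.trace_smul, Matrix.trace_one]
    · simpa using (stinespring_posSemidef U hp).1
  · rintro x ⟨k, p, ρ, hp0, hp1, hρ, hρtr, h, hs, rfl⟩
    have hpos : (∑ i, (p i : ℂ) • ρ i).PosSemidef :=
      Matrix.posSemidef_sum _ fun i _ => (hρ i).smul (by exact_mod_cast hp0 i)
    have htr : (∑ i, (p i : ℂ) • ρ i).trace = 1 := by
      simp only [Matrix.trace_sum, Matrix.trace_smul, hρtr, smul_eq_mul, mul_one]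
      exact_mod_cast hp1
    have h1 := entropy_le_log_card h (stinespring_posSemidef U hpos)
      ((trace_stinespring hU _).trans htr)
    have h2 : ∑ i, p i * m ≤ ∑ i, p i * entropy (hs i) :=
      Finset.sum_le_sum fun i _ =>
        mul_le_mul_of_nonneg_left (hm _ (hs i) (hρ i) (hρtr i)) (hp0 i)
    rw [← Finset.sum_mul, hp1, one_mul] at h2
    linarith

lemma holevo_stinespring_le_log_card [DecidableEq A] [DecidableEq B] [Nonempty A]
    {U : Matrix (B × E) A ℂ} (hU : Uᴴ * U = 1) :
    holevo (stinespring U) ≤ Real.log (Fintype.card B) := by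
  have := holevo_stinespring_le hU (m := 0) fun ρ h hρ htr =>
    entropy_nonneg h (stinespring_posSemidef U hρ) ((trace_stinespring hU _).trans htr)
  simpa using this

lemma holevo_stinespring_le_add_log [DecidableEq A] [DecidableEq B] [Nonempty A]
    {U : Matrix (B × E) A ℂ} (hU : Uᴴ * U = 1)
    {c : ℝ} (hc : ∀ (b : A → ℂ) (v : B → ℂ),
      ∑ e, ‖∑ i, ∑ a, b a * star (U (i, e) a) * v i‖ ^ 2
        ≤ c * (∑ a, ‖b a‖ ^ 2) * ∑ i, ‖v i‖ ^ 2) :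
    holevo (stinespring U) ≤ Real.log (Fintype.card B) + Real.log c := by
  have := holevo_stinespring_le hU (m := -Real.log c) fun ρ h hρ htr =>
    neg_log_le_entropy h (stinespring_posSemidef U hρ) ((trace_stinespring hU _).trans htr)
      (eigenvalues_le_of_re_quadratic_le h (re_quadratic_stinespring_le U hc hρ htr))
  linarith

end Channel

section TensorPower

variable {dA dB dE : ℕ}

/-- The `n`-fold tensor power of `V`. -/
def isometryPow (V : Matrix (Fin dB × Fin dE) (Fin dA) ℂ) (n : ℕ) :
    Matrix ((Fin n → Fin dB) × (Fin n → Fin dE)) (Fin n → Fin dA) ℂ :=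
  Matrix.of fun x a => ∏ t, V (x.1 t, x.2 t) (a t)

lemma PhiPow_eq_stinespring (V : Matrix (Fin dB × Fin dE) (Fin dA) ℂ) (n : ℕ) :
    PhiPow V n = stinespring (isometryPow V n) := by
  ext ρ i j
  simp only [PhiPow, stinespring, krausOp, isometryPow, Matrix.sum_apply, Matrix.mul_apply,
    Matrix.conjTranspose_apply, Matrix.of_apply, Finset.sum_mul]
  exact Finset.sum_congr rfl fun e _ => Finset.sum_comm

lemma sum_sum_prod {X Y : Type*} [Fintype X] [Fintype Y] {n : ℕ}
    (f : Fin n → X → Y → ℂ) :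
    ∑ x : Fin n → X, ∑ y : Fin n → Y, ∏ t, f t (x t) (y t) = ∏ t, ∑ x, ∑ y, f t x y := by
  classical
  simp only [Finset.prod_univ_sum, Fintype.piFinset_univ]

lemma prod_ite_eq_pow {X : Type*} [DecidableEq X] {n : ℕ} (c : ℂ) (i j : Fin n → X) :
    ∏ t, (if i t = j t then c else 0) = if i = j then c ^ n else 0 := by
  split_ifs with h
  · simp [h]
  · obtain ⟨t, ht⟩ := Function.ne_iff.1 h
    exact Finset.prod_eq_zero (Finset.mem_univ t) (if_neg ht)

variable {V : Matrix (Fin dB × Fin dE) (Fin dA) ℂ}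

lemma isometryPow_isometry (hV : Vᴴ * V = 1) (n : ℕ) :
    (isometryPow V n)ᴴ * isometryPow V n = 1 := by
  have hV' : ∀ a a', ∑ i, ∑ e, star (V (i, e) a) * V (i, e) a' = if a = a' then 1 else 0 := by
    intro a a'
    have := congrFun (congrFun hV a) a'
    simpa only [Matrix.mul_apply, Matrix.conjTranspose_apply, Fintype.sum_prod_type,
      Matrix.one_apply] using this
  ext a a'
  simp only [Matrix.mul_apply, Matrix.conjTranspose_apply, Fintype.sum_prod_type,
    Matrix.one_apply, isometryPow, Matrix.of_apply, star_prod, ← Finset.prod_mul_distrib]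
  rw [sum_sum_prod fun t i e => star (V (i, e) (a t)) * V (i, e) (a' t)]
  simp only [hV', prod_ite_eq_pow, one_pow]

lemma isometryPow_unital {c : ℝ}
    (hV : ∀ i j, ∑ e, ∑ a, V (i, e) a * star (V (j, e) a) = if i = j then (c : ℂ) else 0)
    (n : ℕ) (i j : Fin n → Fin dB) :
    ∑ e, ∑ a, isometryPow V n (i, e) a * star (isometryPow V n (j, e) a)
      = if i = j then ((c ^ n : ℝ) : ℂ) else 0 := by
  simp only [isometryPow, Matrix.of_apply, star_prod, ← Finset.prod_mul_distrib]
  rw [sum_sum_prod fun t e a => V (i t, e) a * star (V (j t, e) a)]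
  simp only [hV, prod_ite_eq_pow, Complex.ofReal_pow]

lemma isometryPow_complementary_unital {c : ℝ}
    (hV : ∀ e f, ∑ i, ∑ a, V (i, e) a * star (V (i, f) a) = if e = f then (c : ℂ) else 0)
    (n : ℕ) (e f : Fin n → Fin dE) :
    ∑ i, ∑ a, isometryPow V n (i, e) a * star (isometryPow V n (i, f) a)
      = if e = f then ((c ^ n : ℝ) : ℂ) else 0 := by
  simp only [isometryPow, Matrix.of_apply, star_prod, ← Finset.prod_mul_distrib]
  rw [sum_sum_prod fun t i a => V (i, e t) a * star (V (i, f t) a)]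
  simp only [hV, prod_ite_eq_pow, Complex.ofReal_pow]

lemma sum_mul_star_of_ptraceE (hdA : 0 < dA)
    (h : ptraceE (V * ((dA : ℂ)⁻¹ • (1 : Matrix (Fin dA) (Fin dA) ℂ)) * Vᴴ)
      = (dB : ℂ)⁻¹ • 1) (i j : Fin dB) :
    ∑ e, ∑ a, V (i, e) a * star (V (j, e) a)
      = if i = j then ((dA / dB : ℝ) : ℂ) else 0 := by
  have hA : (dA : ℂ) ≠ 0 := by exact_mod_cast hdA.ne'
  have h1 := congrFun (congrFun h i) j
  simp only [ptraceE, Matrix.mul_smul, Matrix.mul_one, Matrix.smul_apply,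
    smul_eq_mul, Matrix.mul_apply, Matrix.conjTranspose_apply, Matrix.one_apply, mul_assoc] at h1
  simp only [← Finset.mul_sum] at h1
  rw [inv_mul_eq_iff_eq_mul₀ hA] at h1
  rw [h1]
  split_ifs <;> simp [div_eq_mul_inv]

lemma sum_mul_star_of_ptraceB (hdA : 0 < dA)
    (h : ptraceB (V * ((dA : ℂ)⁻¹ • (1 : Matrix (Fin dA) (Fin dA) ℂ)) * Vᴴ)
      = (dE : ℂ)⁻¹ • 1) (e f : Fin dE) :
    ∑ i, ∑ a, V (i, e) a * star (V (i, f) a)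
      = if e = f then ((dA / dE : ℝ) : ℂ) else 0 := by
  have hA : (dA : ℂ) ≠ 0 := by exact_mod_cast hdA.ne'
  have h1 := congrFun (congrFun h e) f
  simp only [ptraceB, Matrix.mul_smul, Matrix.mul_one, Matrix.smul_apply,
    smul_eq_mul, Matrix.mul_apply, Matrix.conjTranspose_apply, Matrix.one_apply, mul_assoc] at h1
  simp only [← Finset.mul_sum] at h1
  rw [inv_mul_eq_iff_eq_mul₀ hA] at h1
  rw [h1]
  split_ifs <;> simp [div_eq_mul_inv]

end TensorPower

/-- for a bistochastic channel with bistochastic complementary channel,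
`χ(Φ^{⊗n}) ≤ n · min{log d_A, log(d_A d_B/d_E)}` for all `n ≥ 1`, and hence the classical
capacity `C(Φ) = lim_n χ(Φ^{⊗n})/n` satisfies
`C(Φ) ≤ min{log d_A, log d_B, log(d_A d_B/d_E)}`. -/
theorem stmt_18 (dA dB dE : ℕ) (hdA : 0 < dA) (hdB : 0 < dB) (hdE : 0 < dE)
    (V : Matrix (Fin dB × Fin dE) (Fin dA) ℂ) (hV : Vᴴ * V = 1)
    (hbi1 : ptraceE (V * ((dA : ℂ)⁻¹ • (1 : Matrix (Fin dA) (Fin dA) ℂ)) * Vᴴ)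
      = (dB : ℂ)⁻¹ • 1)
    (hbi2 : ptraceB (V * ((dA : ℂ)⁻¹ • (1 : Matrix (Fin dA) (Fin dA) ℂ)) * Vᴴ)
      = (dE : ℂ)⁻¹ • 1) :
    (∀ n : ℕ, 1 ≤ n →
      holevo (PhiPow V n) ≤
        n * min (Real.log dA) (Real.log ((dA : ℝ) * dB / dE))) ∧
    (∀ L : ℝ,
      Filter.Tendsto (fun n : ℕ => holevo (PhiPow V n) / n) Filter.atTop (nhds L) →
      L ≤ min (Real.log dA) (min (Real.log dB) (Real.log ((dA : ℝ) * dB / dE)))) := by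
  have hA : (0 : ℝ) < dA := by exact_mod_cast hdA
  have hB : (0 : ℝ) < dB := by exact_mod_cast hdB
  have hE : (0 : ℝ) < dE := by exact_mod_cast hdE
  have : Nonempty (Fin dA) := ⟨⟨0, hdA⟩⟩
  have hcard : ∀ n : ℕ, Real.log (Fintype.card (Fin n → Fin dB)) = n * Real.log dB := by
    intro n
    simp
  have hbound : ∀ n : ℕ, holevo (PhiPow V n) ≤
      n * min (Real.log dA) (Real.log ((dA : ℝ) * dB / dE)) := by
    intro n
    rw [PhiPow_eq_stinespring, mul_min_of_nonneg _ _ n.cast_nonneg]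
    have hU := isometryPow_isometry hV n
    refine le_min ?_ ?_
    · have h1 := holevo_stinespring_le_add_log hU (sum_norm_sq_le_of_unital _
        (isometryPow_unital (sum_mul_star_of_ptraceE hdA hbi1) n))
      rw [hcard, Real.log_pow, Real.log_div hA.ne' hB.ne'] at h1
      linarith
    · have h1 := holevo_stinespring_le_add_log hU (sum_norm_sq_le_of_complementary_unital _
        (isometryPow_complementary_unital (sum_mul_star_of_ptraceB hdA hbi2) n) (by positivity))
      rw [hcard, Real.log_pow, Real.log_div hA.ne' hE.ne'] at h1
      rw [Real.log_div (by positivity) hE.ne', Real.log_mul hA.ne' hB.ne']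
      linarith
  refine ⟨fun n _ => hbound n, fun L hL => le_of_tendsto hL ?_⟩
  filter_upwards [Filter.eventually_gt_atTop 0] with n hn
  have hn' : (0 : ℝ) < n := by exact_mod_cast hn
  rw [min_left_comm]
  refine le_min ?_ ?_ <;> rw [div_le_iff₀' hn']
  · rw [PhiPow_eq_stinespring, ← hcard]
    exact holevo_stinespring_le_log_card (isometryPow_isometry hV n)
  · exact hbound n
end
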